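/- Let u_i be the unique positive classical solution of the degenerate problem (8.44) on Q_i, as constructed in Lemma 8.1. Then for every test function ψ, continuously differentiable on [x_i, x_{i+1}] × [0,T] and vanishing for t near T, one has ∫_{x_i}^{x_{i+1}} u₀(x) ψ(x,0) dx + ∬_{Q_i} ( u_i ψ_t − u_i (u_i)_x ψ_x − (u_i)_x² ψ + u_i (1 − u_i) ψ ) dx dt = 0. -/

import Mathlib

open Set Filter Topology MeasureTheory

/-- `Q_i = (x_i, x_{i+1}) × (0,T]`. -/
def QiSet (xi xip T : ℝ) : Set (ℝ × ℝ) := Set.Ioo xi xip ×ˢ Set.Ioc 0 T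

/-- A solution of the approximating problem (8.45):
`u ∈ C(Q̄_i) ∩ C^{2,1}([x_i,x_{i+1}] × (0,T])` with `u_t = u(u_xx + 1 - u)` in `Q_i`,
boundary values `c` and initial datum `f`. -/
def IsApproxSol (xi xip T c : ℝ) (f : ℝ → ℝ) (u : ℝ → ℝ → ℝ) : Prop :=
  ContinuousOn (fun p : ℝ × ℝ => u p.1 p.2) (Set.Icc xi xip ×ˢ Set.Icc 0 T) ∧
  (∀ t ∈ Set.Ioc (0:ℝ) T, u xi t = c ∧ u xip t = c) ∧
  (∀ x ∈ Set.Icc xi xip, u x 0 = f x) ∧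
  ∃ v1 v2 vt : ℝ → ℝ → ℝ,
    ContinuousOn (fun p : ℝ × ℝ => v1 p.1 p.2) (Set.Icc xi xip ×ˢ Set.Ioc 0 T) ∧
    ContinuousOn (fun p : ℝ × ℝ => v2 p.1 p.2) (Set.Icc xi xip ×ˢ Set.Ioc 0 T) ∧
    ContinuousOn (fun p : ℝ × ℝ => vt p.1 p.2) (Set.Icc xi xip ×ˢ Set.Ioc 0 T) ∧
    (∀ x ∈ Set.Icc xi xip, ∀ t ∈ Set.Ioc (0:ℝ) T,
      HasDerivWithinAt (fun y => u y t) (v1 x t) (Set.Icc xi xip) x ∧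
      HasDerivWithinAt (fun y => v1 y t) (v2 x t) (Set.Icc xi xip) x ∧
      HasDerivWithinAt (fun s => u x s) (vt x t) (Set.Iic T) t) ∧
    (∀ x ∈ Set.Ioo xi xip, ∀ t ∈ Set.Ioc (0:ℝ) T,
      vt x t = u x t * (v2 x t + 1 - u x t))

/-- A positive classical solution of the degenerate problem (8.44):
`u ∈ C(Q̄_i) ∩ C^{2,1}(Q_i)`, positive in `Q_i`, with `u_t = u u_xx + u(1-u)` in `Q_i`,
zero boundary values and initial datum `f`. -/
def IsDegSol (xi xip T : ℝ) (f : ℝ → ℝ) (u : ℝ → ℝ → ℝ) : Prop :=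
  ContinuousOn (fun p : ℝ × ℝ => u p.1 p.2) (Set.Icc xi xip ×ˢ Set.Icc 0 T) ∧
  (∀ t ∈ Set.Ioc (0:ℝ) T, u xi t = 0 ∧ u xip t = 0) ∧
  (∀ x ∈ Set.Icc xi xip, u x 0 = f x) ∧
  (∀ x ∈ Set.Ioo xi xip, ∀ t ∈ Set.Ioc (0:ℝ) T, 0 < u x t) ∧
  (∀ x ∈ Set.Ioo xi xip, ∀ t ∈ Set.Ioc (0:ℝ) T,
    DifferentiableAt ℝ (fun y => u y t) x ∧
    DifferentiableAt ℝ (fun y => deriv (fun z => u z t) y) x ∧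
    DifferentiableWithinAt ℝ (fun s => u x s) (Set.Iic T) t ∧
    derivWithin (fun s => u x s) (Set.Iic T) t
      = u x t * deriv (fun y => deriv (fun z => u z t) y) x + u x t * (1 - u x t)) ∧
  ContinuousOn (fun p : ℝ × ℝ => deriv (fun z => u z p.2) p.1) (QiSet xi xip T) ∧
  ContinuousOn (fun p : ℝ × ℝ => deriv (fun y => deriv (fun z => u z p.2) y) p.1)
    (QiSet xi xip T) ∧
  ContinuousOn (fun p : ℝ × ℝ => derivWithin (fun s => u p.1 s) (Set.Iic T) p.2)
    (QiSet xi xip T)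


/-- The truncation ratio `(s - e)₊ / s`. -/
noncomputable def truncRatio (e s : ℝ) : ℝ := max (s - e) 0 / s

/-- A smooth cutoff of `s`, vanishing for `s ≤ e`. -/
noncomputable def truncPrim (e s : ℝ) : ℝ := s * truncRatio e s ^ 3

/-- The derivative of `truncPrim e`. -/
noncomputable def truncCut (e s : ℝ) : ℝ := 3 * truncRatio e s ^ 2 - 2 * truncRatio e s ^ 3

/-- The derivative of `s * truncCut e s`. -/
noncomputable def truncFluxDeriv (e s : ℝ) : ℝ :=
  6 * truncRatio e s - 9 * truncRatio e s ^ 2 + 4 * truncRatio e s ^ 3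

lemma hasDerivAt_max_zero_pow (n : ℕ) (x : ℝ) :
    HasDerivAt (fun y : ℝ => max y 0 ^ (n + 2)) ((n + 2) * max x 0 ^ (n + 1)) x := by
  rcases lt_trichotomy x 0 with hx | rfl | hx
  · rw [max_eq_right hx.le]
    refine ((hasDerivAt_const x (0 : ℝ)).congr_of_eventuallyEq ?_).congr_deriv (by simp)
    filter_upwards [Iio_mem_nhds hx] with y hy
    simp [max_eq_right (mem_Iio.mp hy).le]
  · simp only [max_self, ne_eq, Nat.add_eq_zero_iff, one_ne_zero, and_false, not_false_eq_true,
      zero_pow, mul_zero]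
    rw [hasDerivAt_iff_isLittleO_nhds_zero]
    simp only [zero_add, max_self, smul_zero, sub_zero, ne_eq, Nat.add_eq_zero_iff,
      OfNat.ofNat_ne_zero, and_false, not_false_eq_true, zero_pow]
    refine Asymptotics.IsBigO.trans_isLittleO (g := fun y : ℝ => y ^ (n + 2)) ?_ ?_
    · refine Asymptotics.IsBigO.of_bound 1 (Eventually.of_forall fun y => ?_)
      rw [one_mul, norm_pow, norm_pow]
      refine pow_le_pow_left₀ (norm_nonneg _) ?_ _
      rw [Real.norm_eq_abs, Real.norm_eq_abs, abs_of_nonneg (le_max_right _ _)]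
      exact max_le (le_abs_self y) (abs_nonneg y)
    · exact Asymptotics.isLittleO_pow_id (by omega)
  · rw [max_eq_left hx.le]
    refine ((hasDerivAt_pow (n + 2) x).congr_of_eventuallyEq ?_).congr_deriv (by push_cast; rfl)
    filter_upwards [Ioi_mem_nhds hx] with y hy
    simp [max_eq_left (mem_Ioi.mp hy).le]

lemma hasDerivAt_max_sub_pow (n : ℕ) (e s : ℝ) :
    HasDerivAt (fun y : ℝ => max (y - e) 0 ^ (n + 2)) ((n + 2) * max (s - e) 0 ^ (n + 1)) s :=
  (hasDerivAt_max_zero_pow n (s - e)).comp_sub_const s e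

lemma hasDerivAt_truncPrim (e : ℝ) {s : ℝ} (hs : 0 < s) :
    HasDerivAt (truncPrim e) (truncCut e s) s := by
  have hw := (hasDerivAt_max_sub_pow 1 e s).div (hasDerivAt_pow 2 s) (by positivity)
  refine (hw.congr_of_eventuallyEq ?_).congr_deriv ?_
  · filter_upwards [Ioi_mem_nhds hs] with y hy
    have : y ≠ 0 := (mem_Ioi.mp hy).ne'
    simp only [truncPrim, truncRatio, Pi.div_apply]
    field_simp
  · simp only [truncCut, truncRatio]
    field_simp
    push_cast
    ring

lemma hasDerivAt_mul_truncCut (e : ℝ) {s : ℝ} (hs : 0 < s) :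
    HasDerivAt (fun y => y * truncCut e y) (truncFluxDeriv e s) s := by
  have hw := (((hasDerivAt_max_sub_pow 0 e s).const_mul 3).div (hasDerivAt_id s) hs.ne').sub
    (((hasDerivAt_max_sub_pow 1 e s).const_mul 2).div (hasDerivAt_pow 2 s) (by positivity))
  refine (hw.congr_of_eventuallyEq ?_).congr_deriv ?_
  · filter_upwards [Ioi_mem_nhds hs] with y hy
    have : y ≠ 0 := (mem_Ioi.mp hy).ne'
    simp only [truncCut, truncRatio, Pi.div_apply, Pi.sub_apply, id]
    field_simp
    ring
  · simp only [truncFluxDeriv, truncRatio, id]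
    field_simp
    push_cast
    ring

lemma continuousOn_truncRatio (e : ℝ) : ContinuousOn (truncRatio e) (Ioi 0) := by
  unfold truncRatio
  exact ContinuousOn.div (by fun_prop) (by fun_prop) fun s hs => (mem_Ioi.mp hs).ne'

lemma truncRatio_of_le {e s : ℝ} (h : s ≤ e) : truncRatio e s = 0 := by
  simp [truncRatio, max_eq_right (sub_nonpos.mpr h)]

lemma truncRatio_mem {e s : ℝ} (he : 0 ≤ e) (hs : 0 < s) : truncRatio e s ∈ Icc (0 : ℝ) 1 := by
  refine ⟨div_nonneg (le_max_right _ _) hs.le, (div_le_one hs).mpr (max_le (by linarith) hs.le)⟩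

lemma truncPrim_mem {e s : ℝ} (he : 0 ≤ e) (hs : 0 < s) : truncPrim e s ∈ Icc 0 s := by
  obtain ⟨h0, h1⟩ := truncRatio_mem he hs
  have h3 : truncRatio e s ^ 3 ≤ 1 := pow_le_one₀ h0 h1
  exact ⟨by unfold truncPrim; positivity, by unfold truncPrim; nlinarith⟩

lemma truncCut_mem {e s : ℝ} (he : 0 ≤ e) (hs : 0 < s) : truncCut e s ∈ Icc (0 : ℝ) 1 := by
  obtain ⟨h0, h1⟩ := truncRatio_mem he hs
  unfold truncCut
  constructor
  · nlinarith [mul_nonneg (sq_nonneg (truncRatio e s)) (sub_nonneg.mpr h1)]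
  · nlinarith [mul_nonneg (sq_nonneg (1 - truncRatio e s)) h0, sq_nonneg (1 - truncRatio e s)]

lemma truncFluxDeriv_mem {e s : ℝ} (he : 0 ≤ e) (hs : 0 < s) :
    truncFluxDeriv e s ∈ Icc (0 : ℝ) 7 := by
  obtain ⟨h0, h1⟩ := truncRatio_mem he hs
  obtain ⟨c0, c1⟩ := truncCut_mem he hs
  have hk : truncFluxDeriv e s
      = truncCut e s + 6 * (truncRatio e s * (1 - truncRatio e s) ^ 2) := by
    unfold truncFluxDeriv truncCut; ring
  have hq : truncRatio e s * (1 - truncRatio e s) ^ 2 ≤ 1 :=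
    mul_le_one₀ h1 (sq_nonneg _) (pow_le_one₀ (by linarith) (by linarith))
  rw [hk]
  exact ⟨by positivity, by linarith⟩

lemma tendsto_truncRatio {ι : Type*} {l : Filter ι} {e v : ι → ℝ} {s : ℝ} (hs : 0 < s)
    (he : Tendsto e l (𝓝 0)) (hv : Tendsto v l (𝓝 s)) :
    Tendsto (fun i => truncRatio (e i) (v i)) l (𝓝 1) := by
  have h := ((hv.sub he).max (tendsto_const_nhds (x := (0 : ℝ)))).div hv hs.ne'
  rwa [sub_zero, max_eq_left hs.le, div_self hs.ne'] at h

lemma tendsto_truncPrim {ι : Type*} {l : Filter ι} {e v : ι → ℝ} {s : ℝ} (hs : 0 < s)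
    (he : Tendsto e l (𝓝 0)) (hv : Tendsto v l (𝓝 s)) :
    Tendsto (fun i => truncPrim (e i) (v i)) l (𝓝 s) := by
  simpa [truncPrim] using hv.mul ((tendsto_truncRatio hs he hv).pow 3)

lemma tendsto_truncCut {ι : Type*} {l : Filter ι} {e : ι → ℝ} {s : ℝ} (hs : 0 < s)
    (he : Tendsto e l (𝓝 0)) : Tendsto (fun i => truncCut (e i) s) l (𝓝 1) := by
  have hr := tendsto_truncRatio hs he (tendsto_const_nhds (x := s))
  have h := ((hr.pow 2).const_mul 3).sub ((hr.pow 3).const_mul 2)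
  norm_num at h
  exact h

lemma tendsto_truncFluxDeriv {ι : Type*} {l : Filter ι} {e : ι → ℝ} {s : ℝ} (hs : 0 < s)
    (he : Tendsto e l (𝓝 0)) : Tendsto (fun i => truncFluxDeriv (e i) s) l (𝓝 1) := by
  have hr := tendsto_truncRatio hs he (tendsto_const_nhds (x := s))
  have h := ((hr.const_mul 6).sub ((hr.pow 2).const_mul 9)).add ((hr.pow 3).const_mul 4)
  norm_num at h
  exact h

/-- The divergence theorem on a rectangle for a field whose normal component vanishes on the
sides `x = a` and `x = b`. -/
lemma setIntegral_rect_sub_of_hasDerivAt {a b c d : ℝ} (hab : a ≤ b) (hcd : c ≤ d)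
    {A B A' B' : ℝ × ℝ → ℝ}
    (hA : ContinuousOn A (Icc a b ×ˢ Icc c d)) (hB : ContinuousOn B (Icc a b ×ˢ Icc c d))
    (hA' : ContinuousOn A' (Icc a b ×ˢ Icc c d)) (hB' : ContinuousOn B' (Icc a b ×ˢ Icc c d))
    (hdA : ∀ x ∈ Icc a b, ∀ t ∈ Ioo c d, HasDerivAt (fun s => A (x, s)) (A' (x, t)) t)
    (hdB : ∀ x ∈ Ioo a b, ∀ t ∈ Icc c d, HasDerivAt (fun y => B (y, t)) (B' (x, t)) x)
    (hBa : ∀ t ∈ Icc c d, B (a, t) = 0) (hBb : ∀ t ∈ Icc c d, B (b, t) = 0) :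
    ∫ p in Icc a b ×ˢ Icc c d, (A' p - B' p) = ∫ x in a..b, (A (x, d) - A (x, c)) := by
  have hK : IsCompact (Icc a b ×ˢ Icc c d) := isCompact_Icc.prod isCompact_Icc
  have hiA : IntegrableOn A' (Icc a b ×ˢ Icc c d) := hA'.integrableOn_compact hK
  have hiB : IntegrableOn B' (Icc a b ×ˢ Icc c d) := hB'.integrableOn_compact hK
  have hx : ∀ {f : ℝ × ℝ → ℝ}, ContinuousOn f (Icc a b ×ˢ Icc c d) → ∀ x ∈ Icc a b,
      ContinuousOn (fun s => f (x, s)) (Icc c d) := fun hf x hx =>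
    hf.comp (by fun_prop) fun s hs => ⟨hx, hs⟩
  have ht : ∀ {f : ℝ × ℝ → ℝ}, ContinuousOn f (Icc a b ×ˢ Icc c d) → ∀ t ∈ Icc c d,
      ContinuousOn (fun y => f (y, t)) (Icc a b) := fun hf t ht =>
    hf.comp (by fun_prop) fun s hs => ⟨hs, ht⟩
  have hIA : ∫ p in Icc a b ×ˢ Icc c d, A' p = ∫ x in a..b, (A (x, d) - A (x, c)) := by
    rw [Measure.volume_eq_prod, setIntegral_prod _ hiA, intervalIntegral.integral_of_le hab,
      ← integral_Icc_eq_integral_Ioc]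
    refine setIntegral_congr_fun measurableSet_Icc fun x hxm => ?_
    rw [integral_Icc_eq_integral_Ioc, ← intervalIntegral.integral_of_le hcd]
    exact intervalIntegral.integral_eq_sub_of_hasDerivAt_of_le hcd (hx hA x hxm) (hdA x hxm)
      ((hx hA' x hxm).intervalIntegrable_of_Icc hcd)
  have hIB : ∫ p in Icc a b ×ˢ Icc c d, B' p = 0 := by
    rw [Measure.volume_eq_prod, ← setIntegral_prod_swap, setIntegral_prod _ ?_]
    · refine setIntegral_eq_zero_of_forall_eq_zero fun t htm => ?_
      simp only [Prod.swap_prod_mk]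
      rw [integral_Icc_eq_integral_Ioc, ← intervalIntegral.integral_of_le hab,
        intervalIntegral.integral_eq_sub_of_hasDerivAt_of_le hab (ht hB t htm)
          (fun x hx => hdB x hx t htm) ((ht hB' t htm).intervalIntegrable_of_Icc hab),
        hBa t htm, hBb t htm, sub_zero]
    · rw [← Measure.volume_eq_prod]
      exact ContinuousOn.integrableOn_compact (isCompact_Icc.prod isCompact_Icc)
        (hB'.comp continuous_swap.continuousOn fun p hp => ⟨hp.2, hp.1⟩)
  rw [integral_sub hiA hiB, hIA, hIB, sub_zero]

lemma integrable_of_tendsto_of_lintegral_le {α : Type*} [MeasurableSpace α] {μ : Measure α}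
    {F : ℕ → α → ℝ} {f : α → ℝ} {C : ENNReal} (hC : C ≠ ⊤)
    (hF : ∀ n, AEStronglyMeasurable (F n) μ)
    (hlim : ∀ᵐ x ∂μ, Tendsto (fun n => F n x) atTop (𝓝 (f x)))
    (hbd : ∀ n, ∫⁻ x, ‖F n x‖ₑ ∂μ ≤ C) : Integrable f μ := by
  refine ⟨aestronglyMeasurable_of_tendsto_ae _ hF hlim, ?_⟩
  have hle : ∫⁻ x, ‖f x‖ₑ ∂μ ≤ liminf (fun n => ∫⁻ x, ‖F n x‖ₑ ∂μ) atTop := by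
    refine le_of_eq_of_le (lintegral_congr_ae ?_)
      (lintegral_liminf_le' fun n => (hF n).aemeasurable.enorm)
    filter_upwards [hlim] with x hx using hx.enorm.liminf_eq.symm
  refine lt_of_le_of_lt (hle.trans ?_) hC.lt_top
  refine liminf_le_of_le (by isBoundedDefault) fun b hb => ?_
  obtain ⟨n, hn⟩ := hb.exists
  exact hn.trans (hbd n)

section TestFunction

variable {ψ : ℝ × ℝ → ℝ}

lemma hasDerivAt_comp_prodMk_left (hψ : ContDiff ℝ 1 ψ) (p : ℝ × ℝ) :
    HasDerivAt (fun s => ψ (p.1, s)) (fderiv ℝ ψ p (0, 1)) p.2 :=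
  ((hψ.differentiable one_ne_zero p).hasFDerivAt).comp_hasDerivAt p.2
    ((hasDerivAt_const p.2 p.1).prodMk (hasDerivAt_id p.2))

lemma hasDerivAt_comp_prodMk_right (hψ : ContDiff ℝ 1 ψ) (p : ℝ × ℝ) :
    HasDerivAt (fun y => ψ (y, p.2)) (fderiv ℝ ψ p (1, 0)) p.1 :=
  ((hψ.differentiable one_ne_zero p).hasFDerivAt).comp_hasDerivAt p.1
    ((hasDerivAt_id p.1).prodMk (hasDerivAt_const p.1 p.2))

lemma continuous_deriv_comp_prodMk_left (hψ : ContDiff ℝ 1 ψ) :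
    Continuous fun p : ℝ × ℝ => deriv (fun s => ψ (p.1, s)) p.2 := by
  simp only [(hasDerivAt_comp_prodMk_left hψ _).deriv]
  exact (hψ.continuous_fderiv one_ne_zero).clm_apply continuous_const

lemma continuous_deriv_comp_prodMk_right (hψ : ContDiff ℝ 1 ψ) :
    Continuous fun p : ℝ × ℝ => deriv (fun y => ψ (y, p.2)) p.1 := by
  simp only [(hasDerivAt_comp_prodMk_right hψ _).deriv]
  exact (hψ.continuous_fderiv one_ne_zero).clm_apply continuous_const

end TestFunction

lemma continuousOn_trunc {α : Type*} [TopologicalSpace α] {v : α → ℝ} {s : Set α} (e : ℝ)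
    (hv : ContinuousOn v s) (hpos : ∀ p ∈ s, 0 < v p) :
    ContinuousOn (fun p => truncPrim e (v p)) s ∧ ContinuousOn (fun p => truncCut e (v p)) s ∧
      ContinuousOn (fun p => truncFluxDeriv e (v p)) s := by
  have hr : ContinuousOn (fun p => truncRatio e (v p)) s :=
    (continuousOn_truncRatio e).comp hv hpos
  unfold truncPrim truncCut truncFluxDeriv
  exact ⟨by fun_prop, by fun_prop, by fun_prop⟩

/-- The integrand of the weak formulation obtained by testing with `truncCut e u * ψ`. -/
noncomputable def truncIntegrand (e : ℝ) (u : ℝ → ℝ → ℝ) (ψ : ℝ × ℝ → ℝ) (p : ℝ × ℝ) : ℝ :=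
  truncPrim e (u p.1 p.2) * deriv (fun s => ψ (p.1, s)) p.2
    - u p.1 p.2 * truncCut e (u p.1 p.2) * deriv (fun y => u y p.2) p.1
      * deriv (fun y => ψ (y, p.2)) p.1
    - truncFluxDeriv e (u p.1 p.2) * deriv (fun y => u y p.2) p.1 ^ 2 * ψ p
    + truncCut e (u p.1 p.2) * (u p.1 p.2 * (1 - u p.1 p.2)) * ψ p

lemma measurableSet_QiSet (xi xip T : ℝ) : MeasurableSet (QiSet xi xip T) :=
  measurableSet_Ioo.prod measurableSet_Ioc

lemma volume_QiSet_ne_top (xi xip T : ℝ) : volume (QiSet xi xip T) ≠ ⊤ := by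
  rw [QiSet, Measure.volume_eq_prod, Measure.prod_prod]
  exact ENNReal.mul_ne_top (by simp) (by simp)

lemma Icc_prod_Icc_subset_QiSet {xi xip T a b δ : ℝ} (hxa : xi < a) (hbx : b < xip)
    (hδ : 0 < δ) : Icc a b ×ˢ Icc δ T ⊆ QiSet xi xip T :=
  prod_mono (Icc_subset_Ioo hxa hbx) fun _ ht => ⟨hδ.trans_le ht.1, ht.2⟩

namespace IsDegSol

variable {xi xip T : ℝ} {f : ℝ → ℝ} {u : ℝ → ℝ → ℝ}

lemma pos (hu : IsDegSol xi xip T f u) {p : ℝ × ℝ} (hp : p ∈ QiSet xi xip T) :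
    0 < u p.1 p.2 :=
  hu.2.2.2.1 p.1 hp.1 p.2 hp.2

lemma continuousOn_QiSet (hu : IsDegSol xi xip T f u) :
    ContinuousOn (fun p : ℝ × ℝ => u p.1 p.2) (QiSet xi xip T) :=
  hu.1.mono (prod_mono Ioo_subset_Icc_self Ioc_subset_Icc_self)

lemma continuousOn_deriv (hu : IsDegSol xi xip T f u) :
    ContinuousOn (fun p : ℝ × ℝ => deriv (fun z => u z p.2) p.1) (QiSet xi xip T) :=
  hu.2.2.2.2.2.1

lemma continuousOn_deriv_deriv (hu : IsDegSol xi xip T f u) :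
    ContinuousOn (fun p : ℝ × ℝ => deriv (fun y => deriv (fun z => u z p.2) y) p.1)
      (QiSet xi xip T) :=
  hu.2.2.2.2.2.2.1

lemma hasDerivAt_space (hu : IsDegSol xi xip T f u) {x t : ℝ} (hx : x ∈ Ioo xi xip)
    (ht : t ∈ Ioc 0 T) : HasDerivAt (fun y => u y t) (deriv (fun y => u y t) x) x :=
  (hu.2.2.2.2.1 x hx t ht).1.hasDerivAt

lemma hasDerivAt_deriv_space (hu : IsDegSol xi xip T f u) {x t : ℝ} (hx : x ∈ Ioo xi xip)
    (ht : t ∈ Ioc 0 T) : HasDerivAt (fun y => deriv (fun z => u z t) y)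
      (deriv (fun y => deriv (fun z => u z t) y) x) x :=
  (hu.2.2.2.2.1 x hx t ht).2.1.hasDerivAt

lemma hasDerivAt_time (hu : IsDegSol xi xip T f u) {x t : ℝ} (hx : x ∈ Ioo xi xip)
    (ht : t ∈ Ioo 0 T) : HasDerivAt (fun s => u x s)
      (u x t * deriv (fun y => deriv (fun z => u z t) y) x + u x t * (1 - u x t)) t := by
  obtain ⟨-, -, hd, he⟩ := hu.2.2.2.2.1 x hx t (Ioo_subset_Ioc_self ht)
  rw [← he]
  exact hd.hasDerivWithinAt.hasDerivAt (Iic_mem_nhds ht.2)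

/-- `u` is small near the lateral sides. -/
lemma exists_lt_near_sides (hu : IsDegSol xi xip T f u) (h : xi < xip) (hxi : f xi = 0)
    (hxip : f xip = 0) {e : ℝ} (he : 0 < e) :
    ∃ a b, xi < a ∧ a < b ∧ b < xip ∧ ∀ x ∈ Icc xi xip, ∀ t ∈ Icc 0 T, x ≤ a ∨ b ≤ x →
      u x t < e := by
  have hside : ∀ t ∈ Icc 0 T, u xi t = 0 ∧ u xip t = 0 := fun t ht => by
    rcases ht.1.eq_or_lt with rfl | h0
    · rw [hu.2.2.1 xi (left_mem_Icc.mpr h.le), hu.2.2.1 xip (right_mem_Icc.mpr h.le)]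
      exact ⟨hxi, hxip⟩
    · exact hu.2.1 t ⟨h0, ht.2⟩
  obtain ⟨η, hη, hd⟩ := Metric.uniformContinuousOn_iff.mp
    ((isCompact_Icc.prod isCompact_Icc).uniformContinuousOn_of_continuous hu.1) e he
  obtain ⟨m, hm0, hm⟩ : ∃ m, 0 < m ∧ m < min η ((xip - xi) / 2) :=
    exists_between (lt_min hη (by linarith))
  obtain ⟨hm1, hm2⟩ := lt_min_iff.mp hm
  refine ⟨xi + m, xip - m, by linarith, by linarith, by linarith, fun x hx t ht hxab => ?_⟩
  have key : ∀ y ∈ Icc xi xip, u y t = 0 → |x - y| < η → u x t < e := fun y hy hy0 hxy => by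
    have hdist := hd (x, t) ⟨hx, ht⟩ (y, t) ⟨hy, ht⟩
      (by simpa [Prod.dist_eq, Real.dist_eq] using hxy)
    simp only [hy0, dist_zero_right] at hdist
    exact (le_abs_self _).trans_lt hdist
  rcases hxab with hxa | hxb
  · exact key xi (left_mem_Icc.mpr h.le) (hside t ht).1
      (by rw [abs_lt]; constructor <;> linarith [hx.1])
  · exact key xip (right_mem_Icc.mpr h.le) (hside t ht).2
      (by rw [abs_lt]; constructor <;> linarith [hx.2])

lemma continuousOn_truncIntegrand (hu : IsDegSol xi xip T f u) {ψ : ℝ × ℝ → ℝ}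
    (hψ : ContDiff ℝ 1 ψ) (e : ℝ) :
    ContinuousOn (truncIntegrand e u ψ) (QiSet xi xip T) := by
  obtain ⟨h1, h2, h3⟩ := continuousOn_trunc e hu.continuousOn_QiSet fun p hp => hu.pos hp
  have h4 := hu.continuousOn_QiSet
  have h5 := hu.continuousOn_deriv
  have h6 := (continuous_deriv_comp_prodMk_left hψ).continuousOn (s := QiSet xi xip T)
  have h7 := (continuous_deriv_comp_prodMk_right hψ).continuousOn (s := QiSet xi xip T)
  have h8 := hψ.continuous.continuousOn (s := QiSet xi xip T)
  unfold truncIntegrand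
  fun_prop

lemma setIntegral_truncIntegrand (hu : IsDegSol xi xip T f u) {ψ : ℝ × ℝ → ℝ}
    (hψ : ContDiff ℝ 1 ψ) {e a b δ : ℝ} (hxa : xi < a) (hab : a ≤ b) (hbx : b < xip)
    (hδ : 0 < δ) (hδT : δ ≤ T) (hua : ∀ t ∈ Icc 0 T, u a t ≤ e)
    (hub : ∀ t ∈ Icc 0 T, u b t ≤ e) :
    ∫ p in Icc a b ×ˢ Icc δ T, truncIntegrand e u ψ p
      = ∫ x in a..b, (truncPrim e (u x T) * ψ (x, T) - truncPrim e (u x δ) * ψ (x, δ)) := by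
  have hsub : Icc a b ×ˢ Icc δ T ⊆ QiSet xi xip T := Icc_prod_Icc_subset_QiSet hxa hbx hδ
  obtain ⟨h1, h2, h3⟩ := continuousOn_trunc e hu.continuousOn_QiSet fun p hp => hu.pos hp
  have h4 := hu.continuousOn_QiSet
  have h5 := hu.continuousOn_deriv
  have h6 := (continuous_deriv_comp_prodMk_left hψ).continuousOn (s := QiSet xi xip T)
  have h7 := (continuous_deriv_comp_prodMk_right hψ).continuousOn (s := QiSet xi xip T)
  have h8 := hψ.continuous.continuousOn (s := QiSet xi xip T)
  have h9 := hu.continuousOn_deriv_deriv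
  have hside : ∀ x t, u x t ≤ e → truncCut e (u x t) = 0 := fun x t hxt => by
    simp [truncCut, truncRatio_of_le hxt]
  have hmain := setIntegral_rect_sub_of_hasDerivAt hab hδT
    (A := fun p => truncPrim e (u p.1 p.2) * ψ p)
    (B := fun p => u p.1 p.2 * truncCut e (u p.1 p.2) * deriv (fun y => u y p.2) p.1 * ψ p)
    (A' := fun p => truncCut e (u p.1 p.2) * (u p.1 p.2 *
        deriv (fun y => deriv (fun z => u z p.2) y) p.1 + u p.1 p.2 * (1 - u p.1 p.2)) * ψ p
      + truncPrim e (u p.1 p.2) * deriv (fun s => ψ (p.1, s)) p.2)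
    (B' := fun p => (truncFluxDeriv e (u p.1 p.2) * deriv (fun y => u y p.2) p.1
        * deriv (fun y => u y p.2) p.1 + u p.1 p.2 * truncCut e (u p.1 p.2) *
          deriv (fun y => deriv (fun z => u z p.2) y) p.1) * ψ p
      + u p.1 p.2 * truncCut e (u p.1 p.2) * deriv (fun y => u y p.2) p.1
        * deriv (fun y => ψ (y, p.2)) p.1)
    (ContinuousOn.mono (by fun_prop) hsub) (ContinuousOn.mono (by fun_prop) hsub)
    (ContinuousOn.mono (by fun_prop) hsub) (ContinuousOn.mono (by fun_prop) hsub)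
    (fun x hx t ht => ?_) (fun x hx t ht => ?_) (fun t ht => ?_) (fun t ht => ?_)
  · rw [← hmain]
    refine setIntegral_congr_fun (measurableSet_Icc.prod measurableSet_Icc) fun p _ => ?_
    simp only [truncIntegrand]
    ring
  · have hxm : x ∈ Ioo xi xip := Icc_subset_Ioo hxa hbx hx
    have ht0 : t ∈ Ioo 0 T := ⟨hδ.trans ht.1, ht.2⟩
    exact ((hasDerivAt_truncPrim e (hu.pos (p := (x, t)) ⟨hxm, Ioo_subset_Ioc_self ht0⟩)).comp t
      (hu.hasDerivAt_time hxm ht0)).mul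
        (hasDerivAt_comp_prodMk_left hψ (x, t)).differentiableAt.hasDerivAt
  · have hxm : x ∈ Ioo xi xip := Icc_subset_Ioo hxa hbx (Ioo_subset_Icc_self hx)
    have ht0 : t ∈ Ioc 0 T := ⟨hδ.trans_le ht.1, ht.2⟩
    exact (((hasDerivAt_mul_truncCut e (hu.pos (p := (x, t)) ⟨hxm, ht0⟩)).comp x
      (hu.hasDerivAt_space hxm ht0)).mul (hu.hasDerivAt_deriv_space hxm ht0)).mul
        (hasDerivAt_comp_prodMk_right hψ (x, t)).differentiableAt.hasDerivAt
  · simp [hside a t (hua t ⟨hδ.le.trans ht.1, ht.2⟩)]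
  · simp [hside b t (hub t ⟨hδ.le.trans ht.1, ht.2⟩)]

/-- An exhaustion of `Q_i` by rectangles, on whose lateral sides `u` is below a level tending
to zero. -/
lemma exists_exhaustion (hu : IsDegSol xi xip T f u) (h : xi < xip) (hT : 0 < T)
    (hxi : f xi = 0) (hxip : f xip = 0) :
    ∃ e δ a b : ℕ → ℝ, (∀ n, 0 < e n) ∧ Tendsto e atTop (𝓝 0) ∧ (∀ n, δ n ∈ Ioc 0 T) ∧
      Tendsto δ atTop (𝓝 0) ∧ (∀ n, xi < a n ∧ a n < b n ∧ b n < xip) ∧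
      (∀ n, ∀ t ∈ Icc 0 T, u (a n) t ≤ e n ∧ u (b n) t ≤ e n) ∧
      ∀ x ∈ Ioo xi xip, ∀ t ∈ Icc 0 T, 0 < u x t → ∀ᶠ n in atTop, x ∈ Icc (a n) (b n) := by
  have he : ∀ n : ℕ, 0 < 1 / ((n : ℝ) + 1) := fun n => by positivity
  have he1 : ∀ n : ℕ, 1 / ((n : ℝ) + 1) ≤ 1 := fun n => by
    rw [div_le_one (by positivity)]
    linarith [Nat.cast_nonneg (α := ℝ) n]
  have he0 := tendsto_one_div_add_atTop_nhds_zero_nat (𝕜 := ℝ)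
  choose a b ha hab hb hlt using fun n => hu.exists_lt_near_sides h hxi hxip (he n)
  refine ⟨fun n => 1 / ((n : ℝ) + 1), fun n => T * (1 / ((n : ℝ) + 1)), a, b, he, he0,
    fun n => ⟨mul_pos hT (he n), mul_le_of_le_one_right hT.le (he1 n)⟩,
    by simpa using he0.const_mul T, fun n => ⟨ha n, hab n, hb n⟩, fun n t ht => ⟨?_, ?_⟩,
    fun x hx t ht hpos => ?_⟩
  · exact (hlt n _ ⟨(ha n).le, ((hab n).trans (hb n)).le⟩ t ht (Or.inl le_rfl)).le
  · exact (hlt n _ ⟨((ha n).trans (hab n)).le, (hb n).le⟩ t ht (Or.inr le_rfl)).le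
  · filter_upwards [he0.eventually_lt_const hpos] with n hn
    constructor
    · by_contra! hc
      exact (hlt n x (Ioo_subset_Icc_self hx) t ht (Or.inl hc.le)).not_gt hn
    · by_contra! hc
      exact (hlt n x (Ioo_subset_Icc_self hx) t ht (Or.inr hc.le)).not_gt hn

lemma exists_bound (hu : IsDegSol xi xip T f u) (h : xi < xip) (hT : 0 < T) :
    ∃ M, 0 ≤ M ∧ ∀ x ∈ Icc xi xip, ∀ t ∈ Icc 0 T, |u x t| ≤ M := by
  obtain ⟨M, hM⟩ := (isCompact_Icc.prod isCompact_Icc).exists_bound_of_continuousOn hu.1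
  exact ⟨M, (abs_nonneg _).trans (hM (xi, 0) ⟨left_mem_Icc.mpr h.le, left_mem_Icc.mpr hT.le⟩),
    fun x hx t ht => hM (x, t) ⟨hx, ht⟩⟩

/-- The energy estimate on a rectangle. -/
lemma setIntegral_truncFluxDeriv_le (hu : IsDegSol xi xip T f u) {e a b δ M : ℝ} (he : 0 ≤ e)
    (hxa : xi < a) (hab : a ≤ b) (hbx : b < xip) (hδ : 0 < δ) (hδT : δ ≤ T)
    (hua : ∀ t ∈ Icc 0 T, u a t ≤ e) (hub : ∀ t ∈ Icc 0 T, u b t ≤ e) (hM0 : 0 ≤ M)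
    (hM : ∀ x ∈ Icc xi xip, ∀ t ∈ Icc 0 T, |u x t| ≤ M) :
    ∫ p in Icc a b ×ˢ Icc δ T,
        truncFluxDeriv e (u p.1 p.2) * deriv (fun y => u y p.2) p.1 ^ 2
      ≤ volume.real (QiSet xi xip T) + M * (xip - xi) := by
  have hsub : Icc a b ×ˢ Icc δ T ⊆ QiSet xi xip T := Icc_prod_Icc_subset_QiSet hxa hbx hδ
  have hK : IsCompact (Icc a b ×ˢ Icc δ T) := isCompact_Icc.prod isCompact_Icc
  have hKm : MeasurableSet (Icc a b ×ˢ Icc δ T) := hK.measurableSet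
  have hψ : ContDiff ℝ 1 fun _ : ℝ × ℝ => (1 : ℝ) := contDiff_const
  obtain ⟨h1, h2, h3⟩ := continuousOn_trunc e hu.continuousOn_QiSet fun p hp => hu.pos hp
  have h4 := hu.continuousOn_QiSet
  have hI := ((hu.continuousOn_truncIntegrand hψ e).mono hsub).integrableOn_compact hK
    (μ := volume)
  have hR : IntegrableOn (fun p : ℝ × ℝ =>
      truncCut e (u p.1 p.2) * (u p.1 p.2 * (1 - u p.1 p.2))) (Icc a b ×ˢ Icc δ T) :=
    ContinuousOn.integrableOn_compact hK (ContinuousOn.mono (by fun_prop) hsub)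
  have hid := hu.setIntegral_truncIntegrand hψ hxa hab hbx hδ hδT hua hub
  have hsplit : ∫ p in Icc a b ×ˢ Icc δ T,
        truncFluxDeriv e (u p.1 p.2) * deriv (fun y => u y p.2) p.1 ^ 2
      = (∫ p in Icc a b ×ˢ Icc δ T, truncCut e (u p.1 p.2) * (u p.1 p.2 * (1 - u p.1 p.2)))
        - ∫ p in Icc a b ×ˢ Icc δ T, truncIntegrand e u (fun _ => 1) p := by
    rw [← integral_sub hR hI]
    refine setIntegral_congr_fun hKm fun p _ => ?_
    simp [truncIntegrand]
  have hreact : ∫ p in Icc a b ×ˢ Icc δ T, truncCut e (u p.1 p.2) * (u p.1 p.2 * (1 - u p.1 p.2))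
      ≤ volume.real (QiSet xi xip T) := by
    refine (setIntegral_mono_on hR (integrableOn_const hK.measure_ne_top (C := (1 : ℝ))) hKm
      fun p hp => ?_).trans ?_
    · obtain ⟨c0, c1⟩ := truncCut_mem he (hu.pos (hsub hp))
      have : u p.1 p.2 * (1 - u p.1 p.2) ≤ 1 := by nlinarith [sq_nonneg (u p.1 p.2 - 1)]
      nlinarith
    · rw [setIntegral_const, smul_eq_mul, mul_one]
      exact measureReal_mono hsub (volume_QiSet_ne_top xi xip T)
  have hcont : ∀ t ∈ Ioc 0 T, IntervalIntegrable (fun x => truncPrim e (u x t)) volume a b :=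
    fun t ht => ContinuousOn.intervalIntegrable_of_Icc hab
      (h1.comp (f := fun x => (x, t)) (by fun_prop)
        fun x hx => ⟨Icc_subset_Ioo hxa hbx hx, ht⟩)
  have hδm : δ ∈ Ioc 0 T := ⟨hδ, hδT⟩
  have hTm : T ∈ Ioc 0 T := ⟨hδ.trans_le hδT, le_rfl⟩
  have hinit : -(M * (xip - xi)) ≤ ∫ x in a..b,
      (truncPrim e (u x T) * 1 - truncPrim e (u x δ) * 1) := by
    have hle : ∫ x in a..b, -M
        ≤ ∫ x in a..b, (truncPrim e (u x T) * 1 - truncPrim e (u x δ) * 1) := by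
      refine intervalIntegral.integral_mono_on hab (by simp)
        (((hcont T hTm).mul_const 1).sub ((hcont δ hδm).mul_const 1)) fun x hx => ?_
      have hxm := Icc_subset_Ioo hxa hbx hx
      have g1 := (truncPrim_mem he (hu.pos (p := (x, T)) ⟨hxm, hTm⟩)).1
      have g2 := (truncPrim_mem he (hu.pos (p := (x, δ)) ⟨hxm, hδm⟩)).2
      have g3 := (le_abs_self _).trans
        (hM x (Ioo_subset_Icc_self hxm) δ (Ioc_subset_Icc_self hδm))
      dsimp only at g1 g2
      linarith
    rw [intervalIntegral.integral_const, smul_eq_mul] at hle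
    nlinarith
  rw [hsplit, hid]
  linarith

/-- The spatial derivative is square integrable. -/
lemma integrableOn_deriv_sq (hu : IsDegSol xi xip T f u) (h : xi < xip) (hT : 0 < T)
    (hxi : f xi = 0) (hxip : f xip = 0) :
    IntegrableOn (fun p : ℝ × ℝ => deriv (fun y => u y p.2) p.1 ^ 2) (QiSet xi xip T) := by
  obtain ⟨e, δ, a, b, he, he0, hδ, hδ0, hab, hside, hev⟩ := hu.exists_exhaustion h hT hxi hxip
  obtain ⟨M, hM0, hM⟩ := hu.exists_bound h hT
  have hsub : ∀ n, Icc (a n) (b n) ×ˢ Icc (δ n) T ⊆ QiSet xi xip T := fun n =>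
    Icc_prod_Icc_subset_QiSet (hab n).1 (hab n).2.2 (hδ n).1
  have hSm : ∀ n, MeasurableSet (Icc (a n) (b n) ×ˢ Icc (δ n) T) := fun n =>
    measurableSet_Icc.prod measurableSet_Icc
  have hcont : ∀ n, ContinuousOn (fun p : ℝ × ℝ =>
      truncFluxDeriv (e n) (u p.1 p.2) * deriv (fun y => u y p.2) p.1 ^ 2) (QiSet xi xip T) :=
    fun n => (continuousOn_trunc (e n) hu.continuousOn_QiSet fun p hp => hu.pos hp).2.2.mul
      (hu.continuousOn_deriv.pow 2)
  refine integrable_of_tendsto_of_lintegral_le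
    (F := fun n => indicator (Icc (a n) (b n) ×ˢ Icc (δ n) T) fun p : ℝ × ℝ =>
      truncFluxDeriv (e n) (u p.1 p.2) * deriv (fun y => u y p.2) p.1 ^ 2)
    (C := ENNReal.ofReal (volume.real (QiSet xi xip T) + M * (xip - xi)))
    ENNReal.ofReal_ne_top (fun n => ?_) ?_ (fun n => ?_)
  · exact ((hcont n).aestronglyMeasurable (measurableSet_QiSet xi xip T)).indicator (hSm n)
  · refine (ae_restrict_iff' (measurableSet_QiSet xi xip T)).mpr (Eventually.of_forall ?_)
    intro p hp
    have hlim := (tendsto_truncFluxDeriv (hu.pos hp) he0).mul_const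
      (deriv (fun y => u y p.2) p.1 ^ 2)
    rw [one_mul] at hlim
    refine hlim.congr' ?_
    filter_upwards [hev p.1 hp.1 p.2 (Ioc_subset_Icc_self hp.2) (hu.pos hp),
      hδ0.eventually_lt_const hp.2.1] with n hn hn'
    rw [indicator_of_mem (show p ∈ Icc (a n) (b n) ×ˢ Icc (δ n) T from
      ⟨hn, hn'.le, hp.2.2⟩)]
  · have hInt : IntegrableOn (fun p : ℝ × ℝ => truncFluxDeriv (e n) (u p.1 p.2)
        * deriv (fun y => u y p.2) p.1 ^ 2) (Icc (a n) (b n) ×ˢ Icc (δ n) T) :=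
      ((hcont n).mono (hsub n)).integrableOn_compact (isCompact_Icc.prod isCompact_Icc)
    simp only [enorm_indicator_eq_indicator_enorm]
    rw [setLIntegral_indicator (hSm n), inter_eq_self_of_subset_left (hsub n),
      ← ofReal_integral_norm_eq_lintegral_enorm hInt]
    refine ENNReal.ofReal_le_ofReal (le_of_eq_of_le ?_
      (hu.setIntegral_truncFluxDeriv_le (he n).le (hab n).1 (hab n).2.1.le (hab n).2.2 (hδ n).1
        (hδ n).2 (fun t ht => (hside n t ht).1) (fun t ht => (hside n t ht).2) hM0 hM))
    refine setIntegral_congr_fun (hSm n) fun p hp => ?_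
    exact Real.norm_of_nonneg
      (mul_nonneg (truncFluxDeriv_mem (he n).le (hu.pos (hsub n hp))).1 (sq_nonneg _))

lemma norm_truncIntegrand_le (hu : IsDegSol xi xip T f u) {ψ : ℝ × ℝ → ℝ} {e M K : ℝ}
    (he : 0 ≤ e) {p : ℝ × ℝ} (hp : p ∈ QiSet xi xip T) (hM : u p.1 p.2 ≤ M) (h1 : |ψ p| ≤ K)
    (h2 : |deriv (fun s => ψ (p.1, s)) p.2| ≤ K)
    (h3 : |deriv (fun y => ψ (y, p.2)) p.1| ≤ K) :
    ‖truncIntegrand e u ψ p‖ ≤ M * K + M * K * (1 + deriv (fun y => u y p.2) p.1 ^ 2)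
      + 7 * K * deriv (fun y => u y p.2) p.1 ^ 2 + M * (1 + M) * K := by
  have hpos := hu.pos hp
  obtain ⟨g0, g1⟩ := truncPrim_mem he hpos
  obtain ⟨c0, c1⟩ := truncCut_mem he hpos
  obtain ⟨d0, d1⟩ := truncFluxDeriv_mem he hpos
  have hK : 0 ≤ K := (abs_nonneg _).trans h1
  have hM0 : 0 ≤ M := hpos.le.trans hM
  have hD : |deriv (fun y => u y p.2) p.1| ≤ 1 + deriv (fun y => u y p.2) p.1 ^ 2 := by
    rw [← sq_abs]
    nlinarith [sq_nonneg (|deriv (fun y => u y p.2) p.1| - 1)]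
  have huc : u p.1 p.2 * truncCut e (u p.1 p.2) ≤ M := by nlinarith
  unfold truncIntegrand
  refine norm_add_le_of_le (norm_sub_le_of_le (norm_sub_le_of_le ?_ ?_) ?_) ?_
  · rw [norm_mul, Real.norm_of_nonneg g0]
    exact mul_le_mul (g1.trans hM) h2 (norm_nonneg _) hM0
  · rw [norm_mul, norm_mul, Real.norm_of_nonneg (mul_nonneg hpos.le c0), mul_right_comm M]
    exact mul_le_mul (mul_le_mul huc hD (norm_nonneg _) hM0) h3 (norm_nonneg _) (by positivity)
  · rw [norm_mul, norm_mul, Real.norm_of_nonneg d0, Real.norm_of_nonneg (sq_nonneg _),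
      mul_right_comm 7]
    exact mul_le_mul (mul_le_mul_of_nonneg_right d1 (sq_nonneg _)) h1 (norm_nonneg _)
      (by positivity)
  · rw [norm_mul, norm_mul, norm_mul, Real.norm_of_nonneg c0, Real.norm_of_nonneg hpos.le]
    refine mul_le_mul ?_ h1 (norm_nonneg _) (by positivity)
    have hq : ‖1 - u p.1 p.2‖ ≤ 1 + M := by
      rw [Real.norm_eq_abs, abs_le]; constructor <;> linarith
    exact (mul_le_of_le_one_left (by positivity) c1).trans
      (mul_le_mul hM hq (norm_nonneg _) hM0)

/-- The weak formulation against test functions vanishing at the final time. -/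
lemma weak_formulation (hu : IsDegSol xi xip T f u) (h : xi < xip) (hT : 0 < T)
    (hpos : ∀ x ∈ Ioo xi xip, 0 < f x) (hxi : f xi = 0) (hxip : f xip = 0) {ψ : ℝ × ℝ → ℝ}
    (hψ : ContDiff ℝ 1 ψ) (hψT : ∀ x, ψ (x, T) = 0) :
    (∫ x in xi..xip, f x * ψ (x, 0)) +
      (∫ p in QiSet xi xip T,
        (u p.1 p.2 * deriv (fun s => ψ (p.1, s)) p.2
          - u p.1 p.2 * deriv (fun y => u y p.2) p.1 * deriv (fun y => ψ (y, p.2)) p.1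
          - (deriv (fun y => u y p.2) p.1) ^ 2 * ψ p
          + u p.1 p.2 * (1 - u p.1 p.2) * ψ p)) = 0 := by
  obtain ⟨e, δ, a, b, he, he0, hδ, hδ0, hab, hside, hev⟩ := hu.exists_exhaustion h hT hxi hxip
  obtain ⟨M, hM0, hM⟩ := hu.exists_bound h hT
  have hsub : ∀ n, Icc (a n) (b n) ×ˢ Icc (δ n) T ⊆ QiSet xi xip T := fun n =>
    Icc_prod_Icc_subset_QiSet (hab n).1 (hab n).2.2 (hδ n).1
  have hSm : ∀ n, MeasurableSet (Icc (a n) (b n) ×ˢ Icc (δ n) T) := fun n =>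
    measurableSet_Icc.prod measurableSet_Icc
  have hQ : QiSet xi xip T ⊆ Icc xi xip ×ˢ Icc 0 T :=
    prod_mono Ioo_subset_Icc_self Ioc_subset_Icc_self
  have hcpt : IsCompact (Icc xi xip ×ˢ Icc 0 T) := isCompact_Icc.prod isCompact_Icc
  obtain ⟨K₁, hK₁⟩ := hcpt.exists_bound_of_continuousOn hψ.continuous.continuousOn
  obtain ⟨K₂, hK₂⟩ := hcpt.exists_bound_of_continuousOn
    (continuous_deriv_comp_prodMk_left hψ).continuousOn
  obtain ⟨K₃, hK₃⟩ := hcpt.exists_bound_of_continuousOn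
    (continuous_deriv_comp_prodMk_right hψ).continuousOn
  set K := max K₁ (max K₂ K₃)
  have hK1 : K₁ ≤ K := le_max_left _ _
  have hK2 : K₂ ≤ K := (le_max_left _ _).trans (le_max_right _ _)
  have hK3 : K₃ ≤ K := (le_max_right _ _).trans (le_max_right _ _)
  have hsq := hu.integrableOn_deriv_sq h hT hxi hxip
  have hone : ∀ c : ℝ, IntegrableOn (fun _ : ℝ × ℝ => c) (QiSet xi xip T) := fun c =>
    integrableOn_const (volume_QiSet_ne_top xi xip T)
  have hbound : IntegrableOn (fun p : ℝ × ℝ =>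
      M * K + M * K * (1 + deriv (fun y => u y p.2) p.1 ^ 2)
        + 7 * K * deriv (fun y => u y p.2) p.1 ^ 2 + M * (1 + M) * K) (QiSet xi xip T) :=
    (((hone (M * K)).add (((hone 1).add hsq).const_mul (M * K))).add
      (hsq.const_mul (7 * K))).add (hone (M * (1 + M) * K))
  have hInt : Tendsto (fun n => ∫ p in Icc (a n) (b n) ×ˢ Icc (δ n) T,
      truncIntegrand (e n) u ψ p) atTop (𝓝 (∫ p in QiSet xi xip T,
        (u p.1 p.2 * deriv (fun s => ψ (p.1, s)) p.2
          - u p.1 p.2 * deriv (fun y => u y p.2) p.1 * deriv (fun y => ψ (y, p.2)) p.1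
          - (deriv (fun y => u y p.2) p.1) ^ 2 * ψ p
          + u p.1 p.2 * (1 - u p.1 p.2) * ψ p))) := by
    have hdct := tendsto_integral_of_dominated_convergence
      (μ := volume.restrict (QiSet xi xip T))
      (F := fun n => indicator (Icc (a n) (b n) ×ˢ Icc (δ n) T) (truncIntegrand (e n) u ψ))
      (f := fun p : ℝ × ℝ => u p.1 p.2 * deriv (fun s => ψ (p.1, s)) p.2
          - u p.1 p.2 * deriv (fun y => u y p.2) p.1 * deriv (fun y => ψ (y, p.2)) p.1
          - (deriv (fun y => u y p.2) p.1) ^ 2 * ψ p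
          + u p.1 p.2 * (1 - u p.1 p.2) * ψ p)
      (fun p : ℝ × ℝ => M * K + M * K * (1 + deriv (fun y => u y p.2) p.1 ^ 2)
        + 7 * K * deriv (fun y => u y p.2) p.1 ^ 2 + M * (1 + M) * K)
      (fun n => ((hu.continuousOn_truncIntegrand hψ (e n)).aestronglyMeasurable
        (measurableSet_QiSet xi xip T)).indicator (hSm n))
      hbound
      (fun n => ?_) ?_
    · refine hdct.congr fun n => ?_
      rw [setIntegral_indicator (hSm n), inter_eq_self_of_subset_right (hsub n)]
    · refine (ae_restrict_iff' (measurableSet_QiSet xi xip T)).mpr (Eventually.of_forall ?_)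
      intro p hp
      refine (norm_indicator_le_norm_self _ _).trans ?_
      exact hu.norm_truncIntegrand_le (he n).le hp
        ((le_abs_self _).trans (hM p.1 (hQ hp).1 p.2 (hQ hp).2))
        ((hK₁ p (hQ hp)).trans hK1) ((hK₂ p (hQ hp)).trans hK2) ((hK₃ p (hQ hp)).trans hK3)
    · refine (ae_restrict_iff' (measurableSet_QiSet xi xip T)).mpr (Eventually.of_forall ?_)
      intro p hp
      have hs := hu.pos hp
      have t1 := tendsto_truncPrim hs he0 (tendsto_const_nhds (x := u p.1 p.2))
      have t2 := tendsto_truncCut hs he0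
      have t3 := tendsto_truncFluxDeriv hs he0
      have hlim : Tendsto (fun n => truncIntegrand (e n) u ψ p) atTop (𝓝 _) :=
        (((t1.mul_const (deriv (fun s => ψ (p.1, s)) p.2)).sub
          (((t2.const_mul (u p.1 p.2)).mul_const (deriv (fun y => u y p.2) p.1)).mul_const
            (deriv (fun y => ψ (y, p.2)) p.1))).sub
          ((t3.mul_const (deriv (fun y => u y p.2) p.1 ^ 2)).mul_const (ψ p))).add
          ((t2.mul_const (u p.1 p.2 * (1 - u p.1 p.2))).mul_const (ψ p))
      simp only [mul_one, one_mul] at hlim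
      refine hlim.congr' ?_
      filter_upwards [hev p.1 hp.1 p.2 (Ioc_subset_Icc_self hp.2) hs,
        hδ0.eventually_lt_const hp.2.1] with n hn hn'
      exact (indicator_of_mem (s := Icc (a n) (b n) ×ˢ Icc (δ n) T)
        ⟨hn, hn'.le, hp.2.2⟩ _).symm
  have hinit : Tendsto (fun n => ∫ x in (a n)..(b n),
      truncPrim (e n) (u x (δ n)) * ψ (x, δ n)) atTop
      (𝓝 (∫ x in xi..xip, f x * ψ (x, 0))) := by
    rw [intervalIntegral.integral_of_le h.le, integral_Ioc_eq_integral_Ioo]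
    have hdct := tendsto_integral_of_dominated_convergence (μ := volume.restrict (Ioo xi xip))
      (F := fun n => indicator (Icc (a n) (b n))
        fun x => truncPrim (e n) (u x (δ n)) * ψ (x, δ n))
      (f := fun x => f x * ψ (x, 0)) (fun _ => M * K)
      (fun n => (ContinuousOn.aestronglyMeasurable (ContinuousOn.mul
        ((continuousOn_trunc (e n) hu.continuousOn_QiSet fun p hp => hu.pos hp).1.comp
          (f := fun x => (x, δ n)) (by fun_prop) fun x hx => ⟨hx, hδ n⟩)
        (hψ.continuous.comp (by fun_prop)).continuousOn) measurableSet_Ioo).indicator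
          measurableSet_Icc)
      (integrableOn_const (by simp)) (fun n => ?_) ?_
    · refine hdct.congr fun n => ?_
      rw [setIntegral_indicator measurableSet_Icc,
        inter_eq_self_of_subset_right (Icc_subset_Ioo (hab n).1 (hab n).2.2),
        intervalIntegral.integral_of_le (hab n).2.1.le, integral_Icc_eq_integral_Ioc]
    · refine (ae_restrict_iff' measurableSet_Ioo).mpr (Eventually.of_forall ?_)
      intro x hx
      have hp : (x, δ n) ∈ QiSet xi xip T := ⟨hx, hδ n⟩
      obtain ⟨g0, g1⟩ := truncPrim_mem (he n).le (hu.pos hp)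
      refine (norm_indicator_le_norm_self _ _).trans ?_
      rw [norm_mul]
      refine mul_le_mul ?_ ((hK₁ _ (hQ hp)).trans hK1) (norm_nonneg _) hM0
      rw [Real.norm_of_nonneg g0]
      exact g1.trans ((le_abs_self _).trans (hM x (hQ hp).1 _ (hQ hp).2))
    · refine (ae_restrict_iff' measurableSet_Ioo).mpr (Eventually.of_forall ?_)
      intro x hx
      have hxI := Ioo_subset_Icc_self hx
      have h0 : u x 0 = f x := hu.2.2.1 x hxI
      have h0T : (0 : ℝ) ∈ Icc 0 T := left_mem_Icc.mpr hT.le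
      have hux : Tendsto (fun n => u x (δ n)) atTop (𝓝 (f x)) := by
        rw [← h0]
        have hc : ContinuousWithinAt (fun t => u x t) (Icc 0 T) 0 :=
          (hu.1.comp (f := fun t => (x, t)) (by fun_prop) fun t ht => ⟨hxI, ht⟩) 0 h0T
        exact hc.tendsto.comp (tendsto_nhdsWithin_iff.mpr
          ⟨hδ0, Eventually.of_forall fun n => Ioc_subset_Icc_self (hδ n)⟩)
      have hψx : Tendsto (fun n => ψ (x, δ n)) atTop (𝓝 (ψ (x, 0))) :=
        (hψ.continuous.tendsto _).comp (tendsto_const_nhds.prodMk_nhds hδ0)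
      refine ((tendsto_truncPrim (hpos x hx) he0 hux).mul hψx).congr' ?_
      filter_upwards [hev x hx 0 h0T (h0 ▸ hpos x hx)] with n hn
      rw [indicator_of_mem hn]
  refine tendsto_nhds_unique (hinit.add hInt) (tendsto_const_nhds.congr fun n => ?_)
  rw [hu.setIntegral_truncIntegrand hψ (hab n).1 (hab n).2.1.le (hab n).2.2 (hδ n).1 (hδ n).2
    (fun t ht => (hside n t ht).1) fun t ht => (hside n t ht).2]
  simp [hψT]

end IsDegSol

/-- Identity (8.51): the positive classical solution `u_i` of the degenerate problem (8.44)
satisfies the weak formulation against every `C¹` test function vanishing for `t` near `T`. -/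
theorem stmt16 (xi xip T : ℝ) (h : xi < xip) (hT : 0 < T)
    (u₀ : ℝ → ℝ) (h₀c : ContinuousOn u₀ (Set.Icc xi xip))
    (h₀pos : ∀ x ∈ Set.Ioo xi xip, 0 < u₀ x)
    (h₀i : u₀ xi = 0) (h₀ip : u₀ xip = 0)
    (ui : ℝ → ℝ → ℝ) (hui : IsDegSol xi xip T u₀ ui) :
    ∀ ψ : ℝ × ℝ → ℝ, ContDiff ℝ 1 ψ →
      (∃ T₀ : ℝ, T₀ < T ∧ ∀ x t : ℝ, T₀ ≤ t → ψ (x, t) = 0) →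
      (∫ x in xi..xip, u₀ x * ψ (x, 0)) +
        (∫ p in QiSet xi xip T,
          (ui p.1 p.2 * deriv (fun s => ψ (p.1, s)) p.2
            - ui p.1 p.2 * deriv (fun y => ui y p.2) p.1 * deriv (fun y => ψ (y, p.2)) p.1
            - (deriv (fun y => ui y p.2) p.1) ^ 2 * ψ p
            + ui p.1 p.2 * (1 - ui p.1 p.2) * ψ p)) = 0 := by
  rintro ψ hψ ⟨T₀, hT₀, hψ₀⟩
  exact hui.weak_formulation h hT h₀pos h₀i h₀ip hψ fun x => hψ₀ x T hT₀.le
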